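/- The derivation-removing homomorphism f: R → AS^{-1} extends uniquely to an injective k-algebra homomorphism f: R[y; τ] → AS^{-1} with f(y) = x, and the further extension f: R[y^{±1}; τ] → AS^{-1} is an isomorphism. Consequently, A and R[y; τ] have equal PI degrees whenever one (hence both) is PI, and if R is a noetherian domain then Fract A ≅ Fract R[y; τ]. -/

import Mathlib

/-- The `q`-integer `(m)_q = q^(m-1) + ⋯ + q + 1`. -/
def qNat {k : Type*} [CommRing k] (q : k) (m : ℕ) : k := ∑ i ∈ Finset.range m, q ^ i

/-- The `q`-factorial `(m)!_q`. -/
def qFact {k : Type*} [CommRing k] (q : k) : ℕ → k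
  | 0 => 1
  | n + 1 => qNat q (n + 1) * qFact q n

/-- The `q`-binomial (Gaussian) coefficient `binom(n,m)_q`, defined via the
Pascal recursion `binom(n+1,m+1)_q = binom(n,m)_q + q^(m+1) binom(n,m+1)_q`. -/
def qBinom {k : Type*} [CommRing k] (q : k) : ℕ → ℕ → k
  | _, 0 => 1
  | 0, _ + 1 => 0
  | n + 1, m + 1 => qBinom q n m + q ^ (m + 1) * qBinom q n (m + 1)

/-- A multilinear identity `Σ_σ c_σ x_{σ(1)} ⋯ x_{σ(n)}` holds in `A`. -/
def IsMulLinIdentity (A : Type*) [Ring A] (n : ℕ)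
    (c : Equiv.Perm (Fin n) → ℤ) : Prop :=
  ∀ f : Fin n → A, ∑ σ : Equiv.Perm (Fin n), c σ • (List.ofFn (f ∘ σ)).prod = 0

/-- `A` satisfies a multilinear identity of degree `n` with coefficient `1`
on the identity permutation. -/
def SatisfiesMulLinIdentity (A : Type*) [Ring A] (n : ℕ) : Prop :=
  ∃ c : Equiv.Perm (Fin n) → ℤ, c 1 = 1 ∧ IsMulLinIdentity A n c

/-- `A` is a PI ring: it satisfies some multilinear identity of positive degree
(every PI ring does, by linearization). -/
def IsPIRing (A : Type*) [Ring A] : Prop :=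
  ∃ n : ℕ, 0 < n ∧ SatisfiesMulLinIdentity A n

/-- The PI degree of `A`: half the minimal degree of a multilinear identity
satisfied by `A`. -/
noncomputable def piDeg (A : Type*) [Ring A] : ℕ :=
  sInf {n : ℕ | 0 < n ∧ SatisfiesMulLinIdentity A n} / 2

section MultilinearIdentities

/-- The value at `v` of the multilinear polynomial `∑ σ, c σ x_{σ(1)} ⋯ x_{σ(n)}`. -/
def mulLinEval {A : Type*} [Ring A] {n : ℕ} (c : Equiv.Perm (Fin n) → ℤ) (v : Fin n → A) : A :=
  ∑ σ : Equiv.Perm (Fin n), c σ • (List.ofFn (v ∘ σ)).prod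

/-- `mulLinEval` as a multilinear map. -/
def mulLinMap (A : Type*) [Ring A] {n : ℕ} (c : Equiv.Perm (Fin n) → ℤ) :
    MultilinearMap ℤ (fun _ : Fin n => A) A :=
  ∑ σ : Equiv.Perm (Fin n), c σ • (MultilinearMap.mkPiAlgebraFin ℤ n A).domDomCongr σ

theorem mulLinMap_apply {A : Type*} [Ring A] {n : ℕ} (c : Equiv.Perm (Fin n) → ℤ)
    (v : Fin n → A) : mulLinMap A c v = mulLinEval c v := by
  simp [mulLinMap, mulLinEval]
  rfl

theorem map_mulLinEval {A B : Type*} [Ring A] [Ring B] (φ : A →+* B) {n : ℕ}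
    (c : Equiv.Perm (Fin n) → ℤ) (v : Fin n → A) :
    φ (mulLinEval c v) = mulLinEval c (φ ∘ v) := by
  simp [mulLinEval, map_list_prod, List.map_ofFn, Function.comp_assoc]

theorem IsMulLinIdentity.of_injective {A B : Type*} [Ring A] [Ring B] (φ : A →+* B)
    (hφ : Function.Injective φ) {n : ℕ} {c : Equiv.Perm (Fin n) → ℤ}
    (h : IsMulLinIdentity B n c) : IsMulLinIdentity A n c := fun v =>
  hφ <| (map_mulLinEval φ c v).trans <| (h (φ ∘ v)).trans (map_zero φ).symm

/-- A multilinear identity can be checked on an additively generating set. -/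
theorem IsMulLinIdentity.of_closure {A : Type*} [Ring A] {n : ℕ} {c : Equiv.Perm (Fin n) → ℤ}
    {S : Set A} (hS : AddSubgroup.closure S = ⊤)
    (h : ∀ v : Fin n → A, (∀ i, v i ∈ S) → mulLinEval c v = 0) : IsMulLinIdentity A n c := by
  have key : ∀ s : Finset (Fin n), ∀ v : Fin n → A, (∀ i ∉ s, v i ∈ S) →
      mulLinMap A c v = 0 := by
    intro s
    induction s using Finset.induction_on with
    | empty =>
      intro v hv
      rw [mulLinMap_apply]
      exact h v fun i => hv i (by simp)
    | insert i s his ih =>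
      intro v hv
      have hz : ∀ z ∈ AddSubgroup.closure S, mulLinMap A c (Function.update v i z) = 0 := by
        intro z hz
        induction hz using AddSubgroup.closure_induction with
        | mem z hz =>
          refine ih _ fun l hl => ?_
          by_cases hli : l = i
          · subst hli; simpa using hz
          · simpa [hli] using hv l (by simp [hli, hl])
        | zero => exact MultilinearMap.map_update_zero _ _ _
        | add x y _ _ hx hy => rw [MultilinearMap.map_update_add, hx, hy, add_zero]
        | neg x _ hx => rw [MultilinearMap.map_update_neg, hx, neg_zero]
      simpa using hz (v i) (by simp [hS])
  intro v
  exact (mulLinMap_apply c v).symm.trans (key Finset.univ v (by simp))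

/-- An exponential sum with invertible commuting shifts that vanishes at all natural numbers
vanishes at all integers. -/
theorem sum_add_zsmul_eq_zero {L M ι : Type*} [AddCommGroup L] [AddCommGroup M]
    (w : ι → L) (s : Finset ι) (G : ι → L → M)
    (h : ∀ (a : ℕ) (l : L), ∑ v ∈ s, G v (l + a • w v) = 0) (a : ℤ) (l : L) :
    ∑ v ∈ s, G v (l + a • w v) = 0 := by
  classical
  induction s using Finset.induction_on generalizing G a l with
  | empty => simp
  | insert t s hts ih =>
    have hd : ∀ (a : ℤ) (l : L), ∑ v ∈ s, (G v (l + a • w v + w v) - G v (l + a • w v + w t)) =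
        ∑ v ∈ insert t s, G v (l + (a + 1) • w v) -
          ∑ v ∈ insert t s, G v (l + w t + a • w v) := by
      intro a l
      rw [← Finset.sum_sub_distrib, Finset.sum_insert hts]
      have h1 : l + (a + 1) • w t = l + w t + a • w t := by rw [add_smul, one_smul]; abel
      rw [h1, sub_self, zero_add]
      refine Finset.sum_congr rfl fun v _ => ?_
      have h2 : l + a • w v + w v = l + (a + 1) • w v := by rw [add_smul, one_smul]; abel
      have h3 : l + a • w v + w t = l + w t + a • w v := by abel
      rw [h2, h3]
    have hstep : ∀ (a : ℤ) (l : L), ∑ v ∈ insert t s, G v (l + (a + 1) • w v) =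
        ∑ v ∈ insert t s, G v (l + w t + a • w v) := by
      intro a l
      rw [← sub_eq_zero, ← hd]
      refine ih (fun v l => G v (l + w v) - G v (l + w t)) (fun a l => ?_) a l
      have hda := hd a l
      have e1 := h (a + 1) l
      have e2 := h a (l + w t)
      simp only [← natCast_zsmul, Nat.cast_add, Nat.cast_one] at e1 e2 ⊢
      rw [hda, e1, e2, sub_self]
    have hneg : ∀ (m : ℕ) (l : L), ∑ v ∈ insert t s, G v (l + (-(m : ℤ)) • w v) = 0 := by
      intro m
      induction m with
      | zero => intro l; simpa using h 0 l
      | succ m ihm =>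
        intro l
        have := hstep (-((m + 1 : ℕ) : ℤ)) (l - w t)
        rw [sub_add_cancel] at this
        rw [← this]
        have e : -((m + 1 : ℕ) : ℤ) + 1 = -(m : ℤ) := by push_cast; ring
        rw [e]
        exact ihm _
    obtain ⟨m, rfl | rfl⟩ := a.eq_nat_or_neg
    · simpa using h m l
    · exact hneg m l

/-- Moving a unit inserted after the `p`-th factor of a product to the right end. -/
theorem prod_ofFn_mul_unit {B : Type*} [Ring B] (u : Bˣ) {n : ℕ} (p : Fin n) (v : Fin n → B) :
    (List.ofFn fun m => if m = p then v m * u else v m).prod =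
      (List.ofFn fun m => if p < m then u * v m * ↑u⁻¹ else v m).prod * u := by
  have hconj : ∀ {n : ℕ} (v : Fin n → B),
      u * (List.ofFn v).prod = (List.ofFn fun m => u * v m * ↑u⁻¹).prod * u := by
    intro n
    induction n with
    | zero => simp
    | succ n ih => 
      intro v
      simp only [List.ofFn_succ, List.prod_cons]
      rw [mul_assoc _ _ (u : B), ← ih]
      simp [mul_assoc]
  induction n with
  | zero => exact p.elim0
  | succ n ih =>
    induction p using Fin.cases with
    | zero => simp [List.ofFn_succ, mul_assoc, hconj]
    | succ p =>
      have := ih p fun m => v m.succ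
      simp [List.ofFn_succ, mul_assoc, (Fin.succ_ne_zero p).symm] at this ⊢
      rw [this]

/-- If a multilinear identity holds on all `h i * X ^ a i` with `h i ∈ C` and `a i ∈ ℕ`, where `C`
is stable under conjugation by the unit `X`, then it holds for all `a i ∈ ℤ`. -/
theorem mulLinEval_mul_zpow_eq_zero {B : Type*} [Ring B] (X : Bˣ) (C : Set B)
    (hC : ∀ (m : ℤ), ∀ v ∈ C, ((X ^ m : Bˣ) : B) * v * ((X ^ m)⁻¹ : Bˣ) ∈ C)
    {n : ℕ} {c : Equiv.Perm (Fin n) → ℤ}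
    (h : ∀ (v : Fin n → B) (a : Fin n → ℕ), (∀ i, v i ∈ C) →
      mulLinEval c (fun i => v i * (X : B) ^ a i) = 0)
    (v : Fin n → B) (a : Fin n → ℤ) (hv : ∀ i, v i ∈ C) :
    mulLinEval c (fun i => v i * ((X ^ a i : Bˣ) : B)) = 0 := by
  have key : ∀ s : Finset (Fin n), ∀ (v : Fin n → B) (a : Fin n → ℤ), (∀ i, v i ∈ C) →
      (∀ i ∉ s, 0 ≤ a i) → mulLinEval c (fun i => v i * ((X ^ a i : Bˣ) : B)) = 0 := by
    intro s
    induction s using Finset.induction_on with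
    | empty =>
      intro v a hv ha
      convert h v (fun i => (a i).toNat) hv using 4 with i
      rw [← Units.val_pow_eq_pow_val, ← zpow_natCast, Int.toNat_of_nonneg (ha i (by simp))]
    | insert p s hps ih =>
      intro v a hv ha
      -- the `p`-th exponent is pulled out to the right, conjugating the later factors
      let V : (Fin n → ℤ) → Fin n → B := fun e i =>
        ((X ^ e i : Bˣ) : B) * v i * ((X ^ e i)⁻¹ : Bˣ)
      let W : (Fin n → ℤ) → Fin n → B := fun e i =>
        V e i * ((X ^ (if i = p then 0 else a i) : Bˣ) : B)
      let w : Equiv.Perm (Fin n) → Fin n → ℤ := fun σ i => if σ.symm p < σ.symm i then 1 else 0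
      have hword : ∀ (σ : Equiv.Perm (Fin n)) (m : ℤ) (e : Fin n → ℤ),
          (List.ofFn ((fun i => V e i * ((X ^ (if i = p then m else a i) : Bˣ) : B)) ∘ σ)).prod =
            (List.ofFn (W (e + m • w σ) ∘ σ)).prod * ((X ^ m : Bˣ) : B) := by
        intro σ m e
        have := prod_ofFn_mul_unit (X ^ m) (σ.symm p) (W e ∘ σ)
        convert this using 4
        · rename_i i
          by_cases hi : σ i = p
          · have hi' : i = σ.symm p := by simp [← hi]
            simp [W, hi']
          · have hi' : i ≠ σ.symm p := by rintro rfl; simp at hi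
            simp [W, hi, hi']
        · funext i
          by_cases hi : σ.symm p < i
          · have h1 : ∀ b : ℤ, (X ^ (e (σ i) + m))⁻¹ * X ^ b = (X ^ e (σ i))⁻¹ * X ^ b * (X ^ m)⁻¹ :=
              fun b => by group
            have h2 : X ^ (e (σ i) + m) = X ^ m * X ^ e (σ i) := by group
            simp only [W, V, w, Function.comp_apply, Pi.add_apply, Pi.smul_apply,
              Equiv.symm_apply_apply, hi, if_true, smul_eq_mul, mul_one]
            rw [mul_assoc, ← Units.val_mul, h1, h2]
            simp only [Units.val_mul, mul_assoc]
          · simp [W, V, w, hi]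
      have hsum : ∀ (m : ℤ) (e : Fin n → ℤ),
          mulLinEval c (fun i => V e i * ((X ^ (if i = p then m else a i) : Bˣ) : B)) =
            (∑ σ, c σ • (List.ofFn (W (e + m • w σ) ∘ σ)).prod) * ((X ^ m : Bˣ) : B) := by
        intro m e
        simp only [mulLinEval, hword, Finset.sum_mul, smul_mul_assoc]
      have hall := sum_add_zsmul_eq_zero w Finset.univ
        (fun σ e => c σ • (List.ofFn (W e ∘ σ)).prod) (fun m e => by
          have h0 := hsum m e
          rw [ih (V e) _ (fun i => hC _ _ (hv i))] at h0
          · simpa only [natCast_zsmul] using (Units.mul_left_eq_zero _).1 h0.symm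
          · intro i hi
            by_cases hip : i = p
            · simp [hip]
            · simpa [hip] using ha i (by simp [hip, hi])) (a p) 0
      have := hsum (a p) 0
      rw [hall, zero_mul] at this
      convert this using 3 with i
      by_cases hip : i = p
      · simp [V, hip]
      · simp [V, hip]
  exact key Finset.univ v a hv (by simp)

end MultilinearIdentities

section Fractions

/-- The universal property of a ring of right fractions. -/
theorem exists_ringHom_of_right_fractions {C P Q : Type*} [Ring C] [Ring P] [Ring Q]
    (ψ : C →+* P) (φ : C →+* Q) (hψ : Function.Injective ψ)
    (hfrac : ∀ u : P, ∃ a s : C, IsUnit (ψ s) ∧ IsUnit (φ s) ∧ u * ψ s = ψ a) :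
    ∃ T : P →+* Q, ∀ a : C, T (ψ a) = φ a := by
  choose num den hden hden' hnum using hfrac
  have ore : ∀ a s : C, IsUnit (ψ s) → ∃ c t : C, IsUnit (ψ t) ∧ IsUnit (φ t) ∧ a * t = s * c := by
    rintro a s ⟨s', hs⟩
    refine ⟨num (↑s'⁻¹ * ψ a), den (↑s'⁻¹ * ψ a), hden _, hden' _, hψ ?_⟩
    rw [map_mul, map_mul, ← hnum, ← hs, ← mul_assoc, ← mul_assoc, Units.mul_inv, one_mul]
  let T : P → Q := fun u => φ (num u) * ((hden' u).unit⁻¹ : Qˣ)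
  have hT : ∀ u, T u * φ (den u) = φ (num u) := fun u => by
    simp [T, mul_assoc]
  have key : ∀ (u : P) (a s : C), IsUnit (ψ s) → IsUnit (φ s) → u * ψ s = ψ a →
      T u * φ s = φ a := by
    intro u a s hs hs' h
    obtain ⟨c, t, -, ht, hts⟩ := ore (den u) s hs
    have h1 : a * c = num u * t := hψ <| by
      rw [map_mul, map_mul, ← h, ← hnum, mul_assoc, mul_assoc, ← map_mul, ← map_mul, hts]
    have h2 : IsUnit (φ c) := by
      have : IsUnit (φ s * φ c) := by rw [← map_mul, ← hts, map_mul]; exact (hden' u).mul ht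
      exact (Units.isUnit_units_mul hs'.unit _).1 this
    apply h2.mul_right_cancel
    rw [mul_assoc, ← map_mul, ← hts, map_mul, ← mul_assoc, hT, ← map_mul, ← map_mul, h1]
  have hC : ∀ a, T (ψ a) = φ a := fun a => by
    simpa using key (ψ a) a 1 (by simp) (by simp) (by simp)
  refine ⟨{ toFun := T, map_one' := ?_, map_zero' := ?_, map_mul' := ?_, map_add' := ?_ }, hC⟩
  · simpa using hC 1
  · intro u v
    obtain ⟨c, t, ht, ht', e⟩ := ore (num v) (den u) (hden u)
    have hu : IsUnit (φ (den v * t)) := by rw [map_mul]; exact (hden' v).mul ht'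
    apply hu.mul_right_cancel
    rw [key (u * v) (num u * c) (den v * t) (by rw [map_mul]; exact (hden v).mul ht) hu, map_mul,
      map_mul, mul_assoc, ← mul_assoc (T v), hT, ← map_mul _ (num v), e, map_mul, ← mul_assoc, hT]
    rw [map_mul, mul_assoc, ← mul_assoc v, hnum, ← map_mul, e, map_mul, ← mul_assoc, hnum, map_mul]
  · simpa using hC 0
  · intro u v
    obtain ⟨c, t, ht, ht', e⟩ := ore (den v) (den u) (hden u)
    have hu : IsUnit (φ (den v * t)) := by rw [map_mul]; exact (hden' v).mul ht'
    apply hu.mul_right_cancel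
    rw [key (u + v) (num u * c + num v * t) (den v * t)
      (by rw [map_mul]; exact (hden v).mul ht) hu, add_mul]
    · conv_rhs => rw [map_mul, ← mul_assoc (T v), hT, ← map_mul, e, map_mul, ← mul_assoc, hT]
      simp
    · rw [add_mul]
      conv_lhs => rw [map_mul, ← mul_assoc v, hnum, ← map_mul, e, map_mul, ← mul_assoc, hnum]
      simp

/-- Division rings of right fractions are unique. -/
theorem nonempty_ringEquiv_of_right_fractions {C D D' : Type*} [Ring C] [DivisionRing D]
    [DivisionRing D'] (ψ : C →+* D) (φ : C →+* D') (hψ : Function.Injective ψ)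
    (hψf : ∀ u : D, ∃ a b : C, b ≠ 0 ∧ u * ψ b = ψ a) (hφ : Function.Injective φ)
    (hφf : ∀ u : D', ∃ a b : C, b ≠ 0 ∧ u * φ b = φ a) : Nonempty (D ≃+* D') := by
  have hψu : ∀ b, b ≠ 0 → IsUnit (ψ b) := fun b hb => ((map_ne_zero_iff ψ hψ).2 hb).isUnit
  have hφu : ∀ b, b ≠ 0 → IsUnit (φ b) := fun b hb => ((map_ne_zero_iff φ hφ).2 hb).isUnit
  obtain ⟨T, hT⟩ := exists_ringHom_of_right_fractions ψ φ hψ fun u => by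
    obtain ⟨a, b, hb, h⟩ := hψf u
    exact ⟨a, b, hψu b hb, hφu b hb, h⟩
  refine ⟨RingEquiv.ofBijective T ⟨T.injective, fun v => ?_⟩⟩
  obtain ⟨a, b, hb, h⟩ := hφf v
  refine ⟨ψ a * (ψ b)⁻¹, ?_⟩
  rw [map_mul, map_inv₀, hT, hT, ← h, mul_assoc, mul_inv_cancel₀ (hφu b hb).ne_zero, mul_one]

end Fractions

section QBinomial

variable {k : Type*} [CommRing k] (q : k)

theorem qBinom_eq_zero_of_lt {n m : ℕ} (h : n < m) : qBinom q n m = 0 := by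
  induction n generalizing m with
  | zero => obtain ⟨m, rfl⟩ := Nat.exists_eq_succ_of_ne_zero h.ne'; rfl
  | succ n ih =>
    obtain ⟨m, rfl⟩ := Nat.exists_eq_succ_of_ne_zero (Nat.ne_zero_of_lt h)
    simp [qBinom, ih (Nat.lt_of_succ_lt_succ h), ih (Nat.lt_of_succ_lt h)]

theorem qBinom_self (n : ℕ) : qBinom q n n = 1 := by
  induction n with
  | zero => rfl
  | succ n ih => simp [qBinom, ih, qBinom_eq_zero_of_lt]

theorem qBinom_succ_self (n : ℕ) : qBinom q (n + 1) n = qNat q (n + 1) := by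
  induction n with
  | zero => simp [qBinom, qNat]
  | succ n ih => rw [qBinom, ih, qBinom_self, mul_one, qNat, qNat, Finset.sum_range_succ _ (n + 1)]

theorem qNat_mul_sub_one (n : ℕ) : qNat q n * (q - 1) = q ^ n - 1 := geom_sum_mul q n

end QBinomial

section RemovingMap

/-- The coefficient `q^{n(n+1)/2} (q-1)^{-n}`. -/
def removingCoeff {k : Type*} [Field k] (q : k) (n : ℕ) : k :=
  q ^ (n * (n + 1) / 2) * ((q - 1)⁻¹) ^ n

/-- `f` is the derivation-removing map attached to the higher `q`-skew derivation `d`, in a ring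
in which the skew variable `X` is a unit. -/
structure IsRemovingMap {k R B : Type*} [Field k] [Ring R] [Algebra k R] [Ring B] [Algebra k B]
    (q : k) (τ : R ≃ₐ[k] R) (d : ℕ → R →ₗ[k] R) (e : R →ₐ[k] B) (X : Bˣ) (f : R → B) : Prop where
  q_ne_zero : q ≠ 0
  q_ne_one : q ≠ 1
  d_zero : d 0 = LinearMap.id
  d_mul : ∀ (n : ℕ) (r s : R), d n (r * s) =
    ∑ i ∈ Finset.range (n + 1), (⇑τ)^[n - i] (d i r) * d (n - i) s
  d_skew : ∀ (i : ℕ) (r : R), d i (τ r) = q ^ i • τ (d i r)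
  d_iter : ∀ (i j : ℕ) (r : R), d i (d j r) = qBinom q (i + j) j • d (i + j) r
  d_nil : ∀ r : R, ∃ N : ℕ, ∀ i ≥ N, d i r = 0
  X_mul : ∀ r : R, (X : B) * e r = e (τ r) * X + e (d 1 r)
  map_eq : ∀ r : R, f r = ∑ᶠ n : ℕ, removingCoeff q n •
    (e (d n ((⇑τ.symm)^[n] r)) * ((X⁻¹ : Bˣ) : B) ^ n)

theorem removingCoeff_zero {k : Type*} [Field k] (q : k) : removingCoeff q 0 = 1 := by
  simp [removingCoeff]

theorem removingCoeff_succ {k : Type*} [Field k] {q : k} (hq : q ≠ 1) (n : ℕ) :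
    removingCoeff q (n + 1) * (q - 1) = removingCoeff q n * q ^ (n + 1) := by
  have h : (n + 1) * (n + 1 + 1) / 2 = n * (n + 1) / 2 + (n + 1) := by
    rw [← Nat.add_mul_div_left _ _ two_pos]; congr 1; ring
  have : q - 1 ≠ 0 := sub_ne_zero.2 hq
  rw [removingCoeff, removingCoeff, h, pow_succ _ n, pow_add, mul_assoc, mul_assoc, mul_assoc,
    inv_mul_cancel₀ this]
  ring

theorem removingCoeff_add {k : Type*} [Field k] (q : k) (i m : ℕ) :
    removingCoeff q (i + m) = q ^ (i * m) * (removingCoeff q i * removingCoeff q m) := by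
  have h : (i + m) * (i + m + 1) / 2 = i * (i + 1) / 2 + m * (m + 1) / 2 + i * m := by
    have h1 := Nat.div_mul_cancel (Nat.even_mul_succ_self i).two_dvd
    have h2 := Nat.div_mul_cancel (Nat.even_mul_succ_self m).two_dvd
    apply Nat.div_eq_of_eq_mul_left two_pos
    linarith
  rw [removingCoeff, removingCoeff, removingCoeff, h]
  ring

namespace IsRemovingMap

variable {k R B : Type*} [Field k] [Ring R] [Algebra k R] [Ring B] [Algebra k B]
  {q : k} {τ : R ≃ₐ[k] R} {d : ℕ → R →ₗ[k] R} {e : R →ₐ[k] B} {X : Bˣ} {f : R → B}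
  (h : IsRemovingMap q τ d e X f)

include h

theorem d_iterate (i m : ℕ) (r : R) : d i ((⇑τ)^[m] r) = q ^ (i * m) • (⇑τ)^[m] (d i r) := by
  induction m with
  | zero => simp
  | succ m ih =>
    rw [Function.iterate_succ_apply', h.d_skew, ih, Function.iterate_succ_apply', map_smul,
      smul_smul, ← pow_add]
    congr 2
    ring

theorem d_symm_iterate (i m : ℕ) (r : R) :
    q ^ (i * m) • d i ((⇑τ.symm)^[m] r) = (⇑τ.symm)^[m] (d i r) := by
  have hl : Function.LeftInverse (⇑τ.symm)^[m] (⇑τ)^[m] :=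
    Function.LeftInverse.iterate τ.symm_apply_apply m
  have hr : Function.LeftInverse (⇑τ)^[m] (⇑τ.symm)^[m] :=
    Function.LeftInverse.iterate τ.apply_symm_apply m
  have := h.d_iterate i m ((⇑τ.symm)^[m] r)
  rw [hr r] at this
  rw [this, ← AlgEquiv.coe_pow τ.symm, map_smul, AlgEquiv.coe_pow, hl]

theorem d_symm_iterate_eq_zero {i : ℕ} {r : R} (hr : d i r = 0) (m : ℕ) :
    d i ((⇑τ.symm)^[m] r) = 0 := by
  have := h.d_symm_iterate i m r
  rw [hr, ← AlgEquiv.coe_pow τ.symm, map_zero, AlgEquiv.coe_pow] at this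
  exact (smul_eq_zero.1 this).resolve_left (pow_ne_zero _ h.q_ne_zero)

theorem eq_sum {r : R} {N : ℕ} (hN : ∀ i ≥ N, d i r = 0) :
    f r = ∑ n ∈ Finset.range N, removingCoeff q n •
      (e (d n ((⇑τ.symm)^[n] r)) * ((X⁻¹ : Bˣ) : B) ^ n) := by
  rw [h.map_eq]
  refine finsum_eq_sum_of_support_subset _ fun n hn => ?_
  by_contra hnN
  apply hn
  simp [h.d_symm_iterate_eq_zero (hN n (by simpa using hnN))]

theorem map_add (r s : R) : f (r + s) = f r + f s := by
  obtain ⟨N, hN⟩ := h.d_nil r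
  obtain ⟨M, hM⟩ := h.d_nil s
  have h1 : ∀ i ≥ max N M, d i r = 0 := fun i hi => hN i ((le_max_left _ _).trans hi)
  have h2 : ∀ i ≥ max N M, d i s = 0 := fun i hi => hM i ((le_max_right _ _).trans hi)
  rw [h.eq_sum h1, h.eq_sum h2, h.eq_sum (N := max N M) fun i hi => by simp [h1 i hi, h2 i hi],
    ← Finset.sum_add_distrib]
  refine Finset.sum_congr rfl fun n _ => ?_
  rw [← AlgEquiv.coe_pow, _root_.map_add, _root_.map_add, _root_.map_add, add_mul, smul_add]

theorem map_smul (a : k) (r : R) : f (a • r) = a • f r := by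
  obtain ⟨N, hN⟩ := h.d_nil r
  rw [h.eq_sum hN, h.eq_sum (N := N) fun i hi => by simp [hN i hi], Finset.smul_sum]
  refine Finset.sum_congr rfl fun n _ => ?_
  rw [← AlgEquiv.coe_pow, _root_.map_smul, _root_.map_smul, _root_.map_smul, smul_mul_assoc,
    smul_comm]

theorem d_one {n : ℕ} (hn : n ≠ 0) : d n 1 = 0 := by
  induction n using Nat.strong_induction_on with
  | _ n ih =>
    have h1 := h.d_mul n 1 1
    rw [mul_one, Finset.sum_range_succ] at h1
    obtain ⟨m, rfl⟩ := Nat.exists_eq_succ_of_ne_zero hn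
    rw [Finset.sum_eq_single_of_mem 0 (by simp) (fun i hi hi0 => by
      rw [ih i (by simpa using hi) hi0, ← AlgEquiv.coe_pow, map_zero, zero_mul])] at h1
    rw [← AlgEquiv.coe_pow, h.d_zero] at h1
    simpa [h.d_zero] using h1

theorem map_one : f 1 = 1 := by
  rw [h.eq_sum (N := 1) fun i hi => h.d_one (by omega)]
  simp [removingCoeff_zero, h.d_zero]

theorem X_mul_map (r : R) : X * f r = f (τ r) * X := by
  obtain ⟨N, hN⟩ := h.d_nil r
  have hN' : ∀ i ≥ N, d i (τ r) = 0 := fun i hi => by rw [h.d_skew, hN i hi]; simp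
  have hts : ∀ n, (⇑τ.symm)^[n + 1] (τ r) = (⇑τ.symm)^[n] r := fun n => by simp
  have hcomm : ∀ n, (⇑τ.symm)^[n] (τ r) = τ ((⇑τ.symm)^[n] r) := fun n => by
    cases n with
    | zero => rfl
    | succ n => rw [hts, Function.iterate_succ_apply', AlgEquiv.apply_symm_apply]
  have key : ∀ N : ℕ, X * (∑ n ∈ Finset.range (N + 1), removingCoeff q n •
      (e (d n ((⇑τ.symm)^[n] r)) * ((X⁻¹ : Bˣ) : B) ^ n)) =
      (∑ n ∈ Finset.range (N + 1), removingCoeff q n •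
      (e (d n ((⇑τ.symm)^[n] (τ r))) * ((X⁻¹ : Bˣ) : B) ^ n)) * X +
      removingCoeff q N • (e (d 1 (d N ((⇑τ.symm)^[N] r))) * ((X⁻¹ : Bˣ) : B) ^ N) := by
    intro N
    induction N with
    | zero => simp [removingCoeff_zero, h.d_zero, h.X_mul]
    | succ N ih =>
      rw [Finset.sum_range_succ, mul_add, ih, Finset.sum_range_succ _ (N + 1), add_mul, add_assoc,
        add_assoc]
      congr 1
      have hX : ((X⁻¹ : Bˣ) : B) ^ (N + 1) * X = ((X⁻¹ : Bˣ) : B) ^ N := by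
        rw [pow_succ, mul_assoc, Units.inv_mul, mul_one]
      have hX' : (X : B) * ((X⁻¹ : Bˣ) : B) ^ (N + 1) = ((X⁻¹ : Bˣ) : B) ^ N := by
        rw [pow_succ', ← mul_assoc, Units.mul_inv, one_mul]
      have hE : d (N + 1) ((⇑τ.symm)^[N] r) =
          q ^ (N + 1) • τ (d (N + 1) ((⇑τ.symm)^[N + 1] r)) := by
        rw [← h.d_skew, ← hcomm, hts]
      have hc : removingCoeff q N * qNat q (N + 1) * q ^ (N + 1) + removingCoeff q (N + 1) =
          removingCoeff q (N + 1) * q ^ (N + 1) := by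
        linear_combination removingCoeff q (N + 1) * qNat_mul_sub_one q (N + 1) -
          qNat q (N + 1) * removingCoeff_succ h.q_ne_one N
      rw [h.d_iter, add_comm 1 N, qBinom_succ_self, hts, hE, mul_smul_comm, ← mul_assoc _ (e _),
        h.X_mul, add_mul, smul_add, ← add_assoc, mul_assoc, hX', smul_mul_assoc, mul_assoc, hX]
      congr 1
      simp only [_root_.map_smul, smul_mul_assoc, smul_smul, ← add_smul]
      rw [← hc, mul_assoc]
  rw [h.eq_sum (N := N + 1) fun i hi => hN i (by omega),
    h.eq_sum (N := N + 1) fun i hi => hN' i (by omega), key, h.d_symm_iterate_eq_zero (hN N le_rfl)]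
  simp

theorem zpow_mul_map (i : ℤ) (r : R) : ∃ s : R, ((X ^ i : Bˣ) : B) * f r = f s * (X ^ i : Bˣ) := by
  have hinv : ∀ r : R, ((X⁻¹ : Bˣ) : B) * f r = f (τ.symm r) * (X⁻¹ : Bˣ) := fun r => by
    rw [Units.inv_mul_eq_iff_eq_mul, ← mul_assoc, h.X_mul_map, AlgEquiv.apply_symm_apply, mul_assoc,
      Units.mul_inv, mul_one]
  induction i with
  | zero => exact ⟨r, by simp⟩
  | succ n ih =>
    obtain ⟨s, hs⟩ := ih
    refine ⟨τ s, ?_⟩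
    rw [add_comm, zpow_add, zpow_one, Units.val_mul, mul_assoc, hs, ← mul_assoc, h.X_mul_map,
      mul_assoc]
  | pred n ih =>
    obtain ⟨s, hs⟩ := ih
    refine ⟨τ.symm s, ?_⟩
    rw [sub_eq_neg_add, zpow_add, zpow_neg_one, Units.val_mul, mul_assoc, hs, ← mul_assoc, hinv,
      mul_assoc]

theorem inv_pow_mul_map (n : ℕ) (r : R) :
    ((X⁻¹ : Bˣ) : B) ^ n * f r = f ((⇑τ.symm)^[n] r) * ((X⁻¹ : Bˣ) : B) ^ n := by
  induction n with
  | zero => simp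
  | succ n ih =>
    rw [pow_succ', mul_assoc, ih, ← mul_assoc, ← mul_assoc, Function.iterate_succ_apply']
    congr 1
    rw [Units.inv_mul_eq_iff_eq_mul, ← mul_assoc, h.X_mul_map, AlgEquiv.apply_symm_apply, mul_assoc,
      Units.mul_inv, mul_one]

theorem map_mul (r s : R) : f (r * s) = f r * f s := by
  obtain ⟨N, hN⟩ := h.d_nil r
  obtain ⟨M, hM⟩ := h.d_nil s
  have hNM : ∀ i ≥ N + M, d i (r * s) = 0 := fun i hi => by
    rw [h.d_mul]
    refine Finset.sum_eq_zero fun l hl => ?_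
    by_cases hlN : N ≤ l
    · rw [hN l hlN, ← AlgEquiv.coe_pow, map_zero, zero_mul]
    · rw [hM (i - l) (by omega), mul_zero]
  let t : ℕ → ℕ → B := fun n m => (removingCoeff q n * removingCoeff q m) •
    (e (d n ((⇑τ.symm)^[n] r)) * e (d m ((⇑τ.symm)^[n + m] s)) * ((X⁻¹ : Bˣ) : B) ^ (n + m))
  have ht : ∀ n m, N ≤ n ∨ M ≤ m → t n m = 0 := by
    rintro n m (hn | hm)
    · simp [t, h.d_symm_iterate_eq_zero (hN n hn)]
    · simp [t, h.d_symm_iterate_eq_zero (hM m hm)]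
  have hl : f (r * s) = ∑ p ∈ Finset.range (N + M), ∑ n ∈ Finset.range (p + 1), t n (p - n) := by
    rw [h.eq_sum hNM]
    refine Finset.sum_congr rfl fun p _ => ?_
    rw [← AlgEquiv.coe_pow, _root_.map_mul, h.d_mul, map_sum, Finset.sum_mul, Finset.smul_sum]
    refine Finset.sum_congr rfl fun n hn => ?_
    obtain ⟨m, rfl⟩ := Nat.exists_eq_add_of_le (Nat.lt_succ_iff.1 (Finset.mem_range.1 hn))
    have h1 := h.d_iterate n m ((⇑τ.symm)^[n + m] r)
    have h2 : (⇑τ)^[m] ((⇑τ.symm)^[n + m] r) = (⇑τ.symm)^[n] r := by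
      rw [add_comm, Function.iterate_add_apply]
      exact Function.LeftInverse.iterate τ.apply_symm_apply m _
    rw [h2] at h1
    simp only [t, add_tsub_cancel_left]
    rw [h1, removingCoeff_add, AlgEquiv.coe_pow, _root_.map_mul, _root_.map_smul, smul_mul_assoc,
      smul_mul_assoc, smul_smul]
    congr 1
    ring
  have hr : f r * f s = ∑ n ∈ Finset.range N, ∑ m ∈ Finset.range M, t n m := by
    rw [h.eq_sum hN, Finset.sum_mul]
    refine Finset.sum_congr rfl fun n _ => ?_
    rw [smul_mul_assoc, mul_assoc, h.inv_pow_mul_map,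
      h.eq_sum fun i hi => h.d_symm_iterate_eq_zero (hM i hi) n, Finset.sum_mul, Finset.mul_sum,
      Finset.smul_sum]
    refine Finset.sum_congr rfl fun m _ => ?_
    simp only [t]
    rw [smul_mul_assoc, mul_smul_comm, smul_smul, ← Function.iterate_add_apply, add_comm m n,
      mul_assoc, ← pow_add, add_comm m n, mul_assoc]
  rw [hl, hr, Finset.sum_sigma', ← Finset.sum_product']
  refine Finset.sum_bij_ne_zero (fun p _ _ => (p.2, p.1 - p.2)) ?_ ?_ ?_ ?_
  · rintro ⟨p, n⟩ hp h0
    have := mt (ht n (p - n)) h0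
    simp only [Finset.mem_product, Finset.mem_range]
    omega
  · rintro ⟨p, n⟩ hp _ ⟨p', n'⟩ hp' _ he
    simp only [Finset.mem_sigma, Finset.mem_range, Prod.mk.injEq] at hp hp' he
    obtain rfl : n = n' := he.1
    obtain rfl : p = p' := by omega
    rfl
  · rintro ⟨n, m⟩ hp h0
    simp only [Finset.mem_product, Finset.mem_range] at hp
    refine ⟨⟨n + m, n⟩, ?_, ?_, ?_⟩
    · simp only [Finset.mem_sigma, Finset.mem_range]
      omega
    · simpa using h0
    · simp
  · rintro ⟨p, n⟩ _ _
    rfl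

/-- The derivation-removing map as an algebra homomorphism. -/
def toAlgHom : R →ₐ[k] B :=
  AlgHom.ofLinearMap ⟨⟨f, h.map_add⟩, h.map_smul⟩ h.map_one h.map_mul

theorem toAlgHom_apply (r : R) : h.toAlgHom r = f r := rfl

end IsRemovingMap
end RemovingMap

section SkewPolynomials

/-- Evaluation of formal left polynomials with coefficients in `R`, mapped by `ι`, at `x`. -/
noncomputable def skewEval {k R A : Type*} [Field k] [Ring R] [Algebra k R] [Ring A] [Algebra k A]
    (ι : R →ₐ[k] A) (x : A) : (ℕ →₀ R) →ₗ[k] A :=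
  Finsupp.lsum k fun i => (LinearMap.mulRight k (x ^ i)).comp ι.toLinearMap

theorem pow_mul_eq_of_skew {R A : Type*} [Monoid A] {τ : R → R} {ι : R → A} {x : A}
    (hrel : ∀ r, x * ι r = ι (τ r) * x)
    (i : ℕ) (r : R) : x ^ i * ι r = ι (τ^[i] r) * x ^ i := by
  induction i with
  | zero => simp
  | succ i ih =>
    rw [pow_succ', mul_assoc, ih, ← mul_assoc, hrel, mul_assoc, Function.iterate_succ_apply']

variable {k R A B : Type*} [Field k] [Ring R] [Algebra k R] [Ring A] [Algebra k A]
  [Ring B] [Algebra k B]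

theorem skewEval_apply (ι : R →ₐ[k] A) (x : A) (c : ℕ →₀ R) :
    skewEval ι x c = c.sum fun i r => ι r * x ^ i := rfl

theorem skewEval_single (ι : R →ₐ[k] A) (x : A) (i : ℕ) (r : R) :
    skewEval ι x (Finsupp.single i r) = ι r * x ^ i := by
  simp [skewEval_apply]

theorem bijective_skewEval {ι : R →ₐ[k] A} {x : A}
    (h : ∀ a : A, ∃! c : ℕ →₀ R, a = c.sum fun i r => ι r * x ^ i) :
    Function.Bijective (skewEval ι x) :=
  (Function.bijective_iff_existsUnique _).2 fun a => by
    simpa only [skewEval_apply, eq_comm] using h a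

theorem closure_monomials_eq_top {ι : R →ₐ[k] A} {x : A}
    (h : Function.Surjective (skewEval ι x)) :
    AddSubgroup.closure {a : A | ∃ (r : R) (i : ℕ), a = ι r * x ^ i} = ⊤ := by
  refine eq_top_iff.2 fun a _ => ?_
  obtain ⟨c, rfl⟩ := h a
  rw [skewEval_apply]
  exact AddSubgroup.sum_mem _ fun i _ => AddSubgroup.subset_closure ⟨_, i, rfl⟩

/-- The universal property of the skew polynomial ring `R[y; τ]`. -/
theorem exists_algHom_of_skew {τ : R → R} {ι : R →ₐ[k] A} {y : A}
    (hbij : Function.Bijective (skewEval ι y)) (hrel : ∀ r, y * ι r = ι (τ r) * y)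
    (F : R →ₐ[k] B) (X : B) (hF : ∀ r, X * F r = F (τ r) * X) :
    ∃ g : A →ₐ[k] B, (∀ r, g (ι r) = F r) ∧ g y = X := by
  let E := LinearEquiv.ofBijective (skewEval ι y) hbij
  let G : A →ₗ[k] B := (skewEval F X).comp E.symm.toLinearMap
  have hG : ∀ r i, G (ι r * y ^ i) = F r * X ^ i := fun r i => by
    rw [← skewEval_single, ← skewEval_single]
    exact congrArg (skewEval F X) (E.symm_apply_apply (Finsupp.single i r))
  have hG1 : G 1 = 1 := by simpa using hG 1 0
  have hmem := fun a : A => (closure_monomials_eq_top hbij.2).ge (AddSubgroup.mem_top a)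
  have hmul : ∀ a b, G (a * b) = G a * G b := by
    intro a b
    induction hmem a using AddSubgroup.closure_induction with
    | zero => simp
    | add a a' _ _ ha ha' => rw [add_mul, map_add, map_add, ha, ha', add_mul]
    | neg a _ ha => rw [neg_mul, map_neg, map_neg, ha, neg_mul]
    | mem a ha =>
      obtain ⟨r, i, rfl⟩ := ha
      induction hmem b using AddSubgroup.closure_induction with
      | zero => simp
      | add b b' _ _ hb hb' => rw [mul_add, map_add, map_add, hb, hb', mul_add]
      | neg b _ hb => rw [mul_neg, map_neg, map_neg, hb, mul_neg]
      | mem b hb =>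
        obtain ⟨s, l, rfl⟩ := hb
        have h1 : ι r * y ^ i * (ι s * y ^ l) = ι (r * τ^[i] s) * y ^ (i + l) := by
          rw [mul_assoc, ← mul_assoc (y ^ i), pow_mul_eq_of_skew hrel, map_mul, pow_add]
          simp only [mul_assoc]
        rw [h1, hG, hG, hG, mul_assoc (F r), ← mul_assoc (X ^ i), pow_mul_eq_of_skew hF, map_mul,
          pow_add]
        simp only [mul_assoc]
  refine ⟨AlgHom.ofLinearMap G hG1 hmul, fun r => ?_, ?_⟩
  · simpa using hG r 0
  · simpa using hG 1 1

end SkewPolynomials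

section LaurentFiltration

/-- The additive subgroup of Laurent polynomials in `X` of degree `< m`, with coefficients on the
left in the image of `u`. -/
def laurentFilt {R B : Type*} [Ring B] (u : R → B) (X : Bˣ) (m : ℤ) : AddSubgroup B :=
  AddSubgroup.closure {b | ∃ (r : R) (i : ℤ), i < m ∧ b = u r * (X ^ i : Bˣ)}

section

variable {R B : Type*} [Ring B] {u : R → B} {X : Bˣ}

theorem mul_zpow_mem_laurentFilt (r : R) {i m : ℤ} (h : i < m) :
    u r * (X ^ i : Bˣ) ∈ laurentFilt u X m :=
  AddSubgroup.subset_closure ⟨r, i, h, rfl⟩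

theorem laurentFilt_mono {m l : ℤ} (h : m ≤ l) : laurentFilt u X m ≤ laurentFilt u X l :=
  AddSubgroup.closure_mono fun _ ⟨r, i, hi, hb⟩ => ⟨r, i, hi.trans_le h, hb⟩

theorem mul_zpow_mem_laurentFilt_add {m : ℤ} {b : B} (hb : b ∈ laurentFilt u X m) (i : ℤ) :
    b * (X ^ i : Bˣ) ∈ laurentFilt u X (m + i) := by
  induction hb using AddSubgroup.closure_induction with
  | zero => simp
  | add a a' _ _ ha ha' => rw [add_mul]; exact add_mem ha ha'
  | neg a _ ha => rw [neg_mul]; exact neg_mem ha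
  | mem a ha =>
    obtain ⟨r, l, hl, rfl⟩ := ha
    rw [mul_assoc, ← Units.val_mul, ← zpow_add]
    exact mul_zpow_mem_laurentFilt r (by linarith)

end

variable {k R A B : Type*} [Field k] [Ring R] [Algebra k R] [Ring A] [Algebra k A]
  [Ring B] [Algebra k B]

/-- Leading coefficients in `AS⁻¹` are well defined. -/
theorem eq_zero_of_mul_zpow_mem_laurentFilt {ι : R →ₐ[k] A} {x : A}
    (hbij : Function.Bijective (skewEval ι x)) {j : A →ₐ[k] B} (hj : Function.Injective j)
    {X : Bˣ} (hX : (X : B) = j x) {r : R} {m : ℤ}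
    (h : j (ι r) * (X ^ m : Bˣ) ∈ laurentFilt (j ∘ ι) X m) : r = 0 := by
  have hmon : ∀ (r : R) (i : ℤ) (M : ℕ), 0 ≤ i + M → j (ι r) * (X ^ i : Bˣ) * (X : B) ^ M =
      j (skewEval ι x (Finsupp.single (i + M).toNat r)) := by
    intro r i M hM
    rw [skewEval_single, map_mul, map_pow, ← hX, mul_assoc, ← Units.val_pow_eq_pow_val,
      ← Units.val_pow_eq_pow_val, ← Units.val_mul, ← zpow_natCast, ← zpow_natCast, ← zpow_add,
      Int.toNat_of_nonneg hM]
  have key : ∀ b ∈ laurentFilt (j ∘ ι) X m, ∃ M₀ : ℕ, ∀ M ≥ M₀, ∃ c : ℕ →₀ R,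
      (∀ i : ℕ, m + M ≤ i → c i = 0) ∧ b * (X : B) ^ M = j (skewEval ι x c) := by
    intro b hb
    induction hb using AddSubgroup.closure_induction with
    | zero => exact ⟨0, fun M _ => ⟨0, by simp, by simp⟩⟩
    | add a a' _ _ ha ha' =>
      obtain ⟨M₁, h₁⟩ := ha
      obtain ⟨M₂, h₂⟩ := ha'
      refine ⟨max M₁ M₂, fun M hM => ?_⟩
      obtain ⟨c₁, hc₁, e₁⟩ := h₁ M ((le_max_left _ _).trans hM)
      obtain ⟨c₂, hc₂, e₂⟩ := h₂ M ((le_max_right _ _).trans hM)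
      exact ⟨c₁ + c₂, fun i hi => by simp [hc₁ i hi, hc₂ i hi], by
        rw [add_mul, e₁, e₂, map_add, map_add]⟩
    | neg a _ ha =>
      obtain ⟨M₁, h₁⟩ := ha
      refine ⟨M₁, fun M hM => ?_⟩
      obtain ⟨c₁, hc₁, e₁⟩ := h₁ M hM
      exact ⟨-c₁, fun i hi => by simp [hc₁ i hi], by rw [neg_mul, e₁, map_neg, map_neg]⟩
    | mem a ha =>
      obtain ⟨s, i, hi, rfl⟩ := ha
      refine ⟨i.natAbs, fun M hM => ⟨_, fun l hl => ?_, hmon s i M (by omega)⟩⟩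
      exact Finsupp.single_eq_of_ne (by omega)
  obtain ⟨M₀, hM₀⟩ := key _ h
  obtain ⟨c, hc, e⟩ := hM₀ (max M₀ m.natAbs) (le_max_left _ _)
  have hM : 0 ≤ m + ((max M₀ m.natAbs : ℕ) : ℤ) := by omega
  rw [hmon r m _ hM] at e
  have := hc (m + ((max M₀ m.natAbs : ℕ) : ℤ)).toNat (by omega)
  rwa [← hbij.1 (hj e), Finsupp.single_eq_same] at this

theorem exists_mem_laurentFilt {ι : R →ₐ[k] A} {x : A}
    (hsurj : Function.Surjective (skewEval ι x)) {j : A →ₐ[k] B}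
    {X : Bˣ} (hX : (X : B) = j x)
    (hfrac : ∀ b : B, ∃ (a : A) (n : ℕ), b = j a * ((X⁻¹ : Bˣ) : B) ^ n) (b : B) :
    ∃ m : ℤ, b ∈ laurentFilt (j ∘ ι) X m := by
  obtain ⟨a, n, rfl⟩ := hfrac b
  have ha : ∃ m : ℤ, j a ∈ laurentFilt (j ∘ ι) X m := by
    induction (closure_monomials_eq_top hsurj).ge (AddSubgroup.mem_top a) using
      AddSubgroup.closure_induction with
    | zero => exact ⟨0, by simp⟩
    | add a a' _ _ ha ha' =>
      obtain ⟨m, hm⟩ := ha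
      obtain ⟨m', hm'⟩ := ha'
      exact ⟨max m m', by
        rw [map_add]
        exact add_mem (laurentFilt_mono (le_max_left _ _) hm)
          (laurentFilt_mono (le_max_right _ _) hm')⟩
    | neg a _ ha =>
      obtain ⟨m, hm⟩ := ha
      exact ⟨m, by rw [map_neg]; exact neg_mem hm⟩
    | mem a ha =>
      obtain ⟨r, i, rfl⟩ := ha
      refine ⟨i + 1, ?_⟩
      rw [map_mul, map_pow, ← hX, ← Units.val_pow_eq_pow_val, ← zpow_natCast]
      exact mul_zpow_mem_laurentFilt (u := j ∘ ι) r (by omega)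
  obtain ⟨m, hm⟩ := ha
  refine ⟨m + -(n : ℤ), ?_⟩
  have := mul_zpow_mem_laurentFilt_add hm (-(n : ℤ))
  rwa [zpow_neg, zpow_natCast, ← inv_pow, Units.val_pow_eq_pow_val] at this

theorem exists_mul_pow_eq {X : Bˣ} {f : R → B} (htop : ∀ b : B, ∃ m : ℤ, b ∈ laurentFilt f X m)
    {ι : R →ₐ[k] A} {y : A} {g : A →ₐ[k] B}
    (hg : ∀ r, g (ι r) = f r) (hgy : g y = X) (b : B) :
    ∃ (a : A) (n : ℕ), b * (X : B) ^ n = g a := by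
  obtain ⟨m, hm⟩ := htop b
  induction hm using AddSubgroup.closure_induction with
  | zero => exact ⟨0, 0, by simp⟩
  | add b b' _ _ hb hb' =>
    obtain ⟨a, n, ha⟩ := hb
    obtain ⟨a', n', ha'⟩ := hb'
    refine ⟨a * y ^ n' + a' * y ^ n, n + n', ?_⟩
    rw [map_add, map_mul, map_mul, ← ha, ← ha', map_pow, map_pow, hgy, add_mul,
      mul_assoc, mul_assoc, ← pow_add, ← pow_add, add_comm n' n]
  | neg b _ hb =>
    obtain ⟨a, n, ha⟩ := hb
    exact ⟨-a, n, by rw [neg_mul, ha, map_neg]⟩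
  | mem b hb =>
    obtain ⟨r, i, -, rfl⟩ := hb
    refine ⟨ι r * y ^ (i + i.natAbs).toNat, i.natAbs, ?_⟩
    rw [map_mul, map_pow, hg, hgy, mul_assoc, ← Units.val_pow_eq_pow_val,
      ← Units.val_pow_eq_pow_val, ← Units.val_mul, ← zpow_natCast, ← zpow_natCast, ← zpow_add,
      Int.toNat_of_nonneg (by omega)]

theorem injective_of_leadingCoeff {X : Bˣ} {f : R → B}
    (hlead : ∀ (r : R) (m : ℤ), f r * (X ^ m : Bˣ) ∈ laurentFilt f X m → r = 0)
    {ι : R →ₐ[k] A} {y : A} (hsurj : Function.Surjective (skewEval ι y)) {g : A →ₐ[k] B}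
    (hg : ∀ r, g (ι r) = f r) (hgy : g y = X) : Function.Injective g := by
  refine (injective_iff_map_eq_zero g).2 fun a ha => ?_
  obtain ⟨c, rfl⟩ := hsurj a
  by_contra hne
  have hc : c.support.Nonempty := by
    rw [Finsupp.support_nonempty_iff]
    rintro rfl
    simp at hne
  have hmem := c.support.max'_mem hc
  set N := c.support.max' hc with hN
  refine Finsupp.mem_support_iff.1 hmem (hlead _ N ?_)
  have hsum : ∀ (i : ℕ) (r : R), g (ι r * y ^ i) = f r * (X ^ (i : ℤ) : Bˣ) := fun i r => by
    rw [map_mul, map_pow, hg, hgy, zpow_natCast, Units.val_pow_eq_pow_val]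
  rw [skewEval_apply, Finsupp.sum, map_sum, ← Finset.add_sum_erase _ _ hmem, hsum,
    add_eq_zero_iff_eq_neg] at ha
  rw [ha]
  refine neg_mem (sum_mem fun i hi => ?_)
  rw [hsum]
  refine mul_zpow_mem_laurentFilt _ ?_
  have := c.support.lt_max'_of_mem_erase_max' hc hi
  exact_mod_cast this

namespace IsRemovingMap

variable {q : k} {τ : R ≃ₐ[k] R} {d : ℕ → R →ₗ[k] R} {e : R →ₐ[k] B} {X : Bˣ} {f : R → B}
  (h : IsRemovingMap q τ d e X f)

include h

theorem eq_add_sum {r : R} {N : ℕ} (hN : ∀ i ≥ N + 1, d i r = 0) :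
    f r = e r + ∑ n ∈ Finset.range N, e (removingCoeff q (n + 1) •
      d (n + 1) ((⇑τ.symm)^[n + 1] r)) * (X ^ (-((n + 1 : ℕ) : ℤ)) : Bˣ) := by
  rw [h.eq_sum hN, Finset.sum_range_succ', add_comm]
  congr 1
  · simp [removingCoeff_zero, h.d_zero]
  · refine Finset.sum_congr rfl fun n _ => ?_
    rw [_root_.map_smul, smul_mul_assoc, zpow_neg, zpow_natCast, ← inv_pow,
      Units.val_pow_eq_pow_val]

theorem map_sub_mem (r : R) : f r - e r ∈ laurentFilt e X 0 := by
  obtain ⟨N, hN⟩ := h.d_nil r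
  rw [h.eq_add_sum (N := N) fun i hi => hN i (by omega), add_sub_cancel_left]
  exact sum_mem fun n _ => mul_zpow_mem_laurentFilt _ (by omega)

theorem sub_map_mem (r : R) : e r - f r ∈ laurentFilt f X 0 := by
  obtain ⟨N, hN⟩ := h.d_nil r
  induction N generalizing r with
  | zero =>
    have : r = 0 := by simpa [h.d_zero] using hN 0 le_rfl
    rw [this, ← h.toAlgHom_apply]
    simp
  | succ N ih =>
    rw [h.eq_add_sum hN, sub_add_cancel_left]
    refine neg_mem (sum_mem fun n _ => ?_)
    set s := removingCoeff q (n + 1) • d (n + 1) ((⇑τ.symm)^[n + 1] r)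
    have hs : ∀ i ≥ N, d i s = 0 := fun i hi => by
      rw [_root_.map_smul, h.d_iter, h.d_symm_iterate_eq_zero (hN _ (by omega)), smul_zero,
        smul_zero]
    rw [← sub_add_cancel (e s) (f s), add_mul]
    exact add_mem (laurentFilt_mono (by omega) (mul_zpow_mem_laurentFilt_add (ih s hs) _))
      (mul_zpow_mem_laurentFilt _ (by omega))

theorem laurentFilt_eq (m : ℤ) : laurentFilt f X m = laurentFilt e X m := by
  apply le_antisymm <;> refine (AddSubgroup.closure_le _).2 ?_ <;> rintro _ ⟨r, i, hi, rfl⟩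
  · rw [← sub_add_cancel (f r) (e r), add_mul]
    exact add_mem (laurentFilt_mono (by omega) (mul_zpow_mem_laurentFilt_add (h.map_sub_mem r) i))
      (mul_zpow_mem_laurentFilt r hi)
  · rw [← sub_add_cancel (e r) (f r), add_mul]
    exact add_mem (laurentFilt_mono (by omega) (mul_zpow_mem_laurentFilt_add (h.sub_map_mem r) i))
      (mul_zpow_mem_laurentFilt r hi)

theorem mul_zpow_mul (r s : R) (i l : ℤ) : ∃ t : R,
    f r * (X ^ i : Bˣ) * (f s * (X ^ l : Bˣ)) = f t * (X ^ (i + l) : Bˣ) := by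
  obtain ⟨t, ht⟩ := h.zpow_mul_map i s
  refine ⟨r * t, ?_⟩
  rw [mul_assoc, ← mul_assoc _ (f s), ht, h.map_mul, zpow_add, Units.val_mul]
  simp only [mul_assoc]

theorem mul_mem_laurentFilt {b c : B} {m l : ℤ} (hb : b ∈ laurentFilt f X m)
    (hc : c ∈ laurentFilt f X l) : b * c ∈ laurentFilt f X (m + l - 1) := by
  induction hb using AddSubgroup.closure_induction with
  | zero => simp
  | add a a' _ _ ha ha' => rw [add_mul]; exact add_mem ha ha'
  | neg a _ ha => rw [neg_mul]; exact neg_mem ha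
  | mem a ha =>
    obtain ⟨r, i, hi, rfl⟩ := ha
    induction hc using AddSubgroup.closure_induction with
    | zero => simp
    | add a a' _ _ ha ha' => rw [mul_add]; exact add_mem ha ha'
    | neg a _ ha => rw [mul_neg]; exact neg_mem ha
    | mem a ha =>
      obtain ⟨s, i', hi', rfl⟩ := ha
      obtain ⟨t, ht⟩ := h.mul_zpow_mul r s i i'
      rw [ht]
      exact mul_zpow_mem_laurentFilt t (by omega)

theorem exists_prod_eq {ι : Type*} (r : ι → R) (a : ι → ℤ) (L : List ι) : ∃ s : R,
    (L.map fun i => f (r i) * (X ^ a i : Bˣ)).prod = f s * (X ^ (L.map a).sum : Bˣ) := by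
  induction L with
  | nil => exact ⟨1, by simp [h.map_one]⟩
  | cons i L ih =>
    obtain ⟨s, hs⟩ := ih
    rw [List.map_cons, List.prod_cons, hs, List.map_cons, List.sum_cons]
    exact h.mul_zpow_mul _ _ _ _

/-- Words in `e r * X ^ i` and in `f r * X ^ i` have the same leading term. -/
theorem prod_sub_prod_mem {ι : Type*} (r : ι → R) (a : ι → ℤ) (L : List ι) :
    (L.map fun i => f (r i) * (X ^ a i : Bˣ)).prod -
      (L.map fun i => e (r i) * (X ^ a i : Bˣ)).prod ∈ laurentFilt f X (L.map a).sum := by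
  induction L with
  | nil => simp
  | cons i L ih =>
    simp only [List.map_cons, List.prod_cons, List.sum_cons]
    set F := (L.map fun i => f (r i) * ((X ^ a i : Bˣ) : B)).prod with hF
    set P := (L.map fun i => e (r i) * ((X ^ a i : Bˣ) : B)).prod
    have hFm : F ∈ laurentFilt f X ((L.map a).sum + 1) := by
      obtain ⟨s, hs⟩ := h.exists_prod_eq r a L
      rw [hF, hs]
      exact mul_zpow_mem_laurentFilt s (by omega)
    have h1 : (f (r i) - e (r i)) * (X ^ a i : Bˣ) ∈ laurentFilt f X (0 + a i) := by
      rw [← neg_sub, neg_mul]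
      exact neg_mem (mul_zpow_mem_laurentFilt_add (h.sub_map_mem _) _)
    have h2 : e (r i) * (X ^ a i : Bˣ) ∈ laurentFilt f X (a i + 1) := by
      rw [h.laurentFilt_eq]
      exact mul_zpow_mem_laurentFilt _ (by omega)
    have h3 : f (r i) * (X ^ a i : Bˣ) * F - e (r i) * (X ^ a i : Bˣ) * P =
        (f (r i) - e (r i)) * (X ^ a i : Bˣ) * F + e (r i) * (X ^ a i : Bˣ) * (F - P) := by
      noncomm_ring
    rw [h3]
    exact add_mem (laurentFilt_mono (by omega) (h.mul_mem_laurentFilt h1 hFm))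
      (laurentFilt_mono (by omega) (h.mul_mem_laurentFilt h2 ih))

theorem mulLinEval_map_eq_zero
    (hlead : ∀ (r : R) (m : ℤ), f r * (X ^ m : Bˣ) ∈ laurentFilt f X m → r = 0)
    {n : ℕ} {c : Equiv.Perm (Fin n) → ℤ} {r : Fin n → R} {a : Fin n → ℤ}
    (hc : mulLinEval c (fun i => e (r i) * ((X ^ a i : Bˣ) : B)) = 0) :
    mulLinEval c (fun i => f (r i) * ((X ^ a i : Bˣ) : B)) = 0 := by
  have hsum : ∀ σ : Equiv.Perm (Fin n), ((List.ofFn σ).map a).sum = ∑ i, a i := fun σ => by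
    rw [List.map_ofFn, List.sum_ofFn]
    exact Equiv.sum_comp σ a
  have hex : ∀ σ : Equiv.Perm (Fin n), ∃ s : R,
      (List.ofFn ((fun i => f (r i) * ((X ^ a i : Bˣ) : B)) ∘ σ)).prod =
        f s * (X ^ (∑ i, a i) : Bˣ) := fun σ => by
    rw [← List.map_ofFn, ← hsum σ]
    exact h.exists_prod_eq r a _
  choose s hs using hex
  have hmem : mulLinEval c (fun i => f (r i) * ((X ^ a i : Bˣ) : B)) ∈
      laurentFilt f X (∑ i, a i) := by
    rw [← sub_zero (mulLinEval c _), ← hc, mulLinEval, mulLinEval, ← Finset.sum_sub_distrib]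
    refine sum_mem fun σ _ => ?_
    rw [← smul_sub, ← List.map_ofFn, ← List.map_ofFn, ← hsum σ]
    exact zsmul_mem (h.prod_sub_prod_mem r a _) _
  have heq : mulLinEval c (fun i => f (r i) * ((X ^ a i : Bˣ) : B)) =
      f (∑ σ, c σ • s σ) * (X ^ (∑ i, a i) : Bˣ) := by
    rw [← h.toAlgHom_apply, map_sum, Finset.sum_mul, mulLinEval]
    refine Finset.sum_congr rfl fun σ _ => ?_
    rw [hs, map_zsmul, h.toAlgHom_apply, smul_mul_assoc]
  rw [heq] at hmem ⊢
  rw [hlead _ _ hmem, ← h.toAlgHom_apply, map_zero, zero_mul]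

theorem isMulLinIdentity_of_monomials (htop : ∀ b : B, ∃ m : ℤ, b ∈ laurentFilt f X m)
    {n : ℕ} {c : Equiv.Perm (Fin n) → ℤ}
    (hc : ∀ (r : Fin n → R) (a : Fin n → ℕ),
      mulLinEval c (fun i => f (r i) * (X : B) ^ a i) = 0) : IsMulLinIdentity B n c := by
  refine IsMulLinIdentity.of_closure
    (S := {b | ∃ (r : R) (i : ℤ), b = f r * (X ^ i : Bˣ)}) ?_ fun v hv => ?_
  · refine eq_top_iff.2 fun b _ => ?_
    obtain ⟨m, hm⟩ := htop b
    exact AddSubgroup.closure_mono (by rintro _ ⟨r, i, -, rfl⟩; exact ⟨r, i, rfl⟩) hm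
  · choose r a hra using hv
    obtain rfl : v = fun i => f (r i) * ((X ^ a i : Bˣ) : B) := funext hra
    refine mulLinEval_mul_zpow_eq_zero X (Set.range f) ?_ ?_ _ a fun i => ⟨r i, rfl⟩
    · rintro m _ ⟨s, rfl⟩
      obtain ⟨t, ht⟩ := h.zpow_mul_map m s
      exact ⟨t, by rw [ht, mul_assoc, Units.mul_inv, mul_one]⟩
    · intro v a hv
      choose r hr using hv
      obtain rfl : (fun i => f (r i)) = v := funext hr
      exact hc r a

end IsRemovingMap

end LaurentFiltration

section FractionRings

/-- If `B` is obtained both from `A` and from `A'` by inverting a single element `X`, then division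
rings of fractions of `A` and `A'` are isomorphic. -/
theorem nonempty_ringEquiv_of_common_localization {A A' B D D' : Type*} [Ring A] [Ring A'] [Ring B]
    [DivisionRing D] [DivisionRing D'] {j : A →+* B} (hj : Function.Injective j) {x : A} {X : Bˣ}
    (hX : (X : B) = j x) (hjf : ∀ b : B, ∃ (a : A) (n : ℕ), b * (X : B) ^ n = j a)
    {g : A' →+* B} (hg : Function.Injective g)
    (hgf : ∀ b : B, ∃ (a : A') (n : ℕ), b * (X : B) ^ n = g a) {y : A'} (hy : g y = X)
    {φ : A →+* D} {φ' : A' →+* D'} (hφ : Function.Injective φ)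
    (hφf : ∀ u : D, ∃ a b : A, b ≠ 0 ∧ u * φ b = φ a) (hφ' : Function.Injective φ')
    (hφf' : ∀ u : D', ∃ a b : A', b ≠ 0 ∧ u * φ' b = φ' a) : Nonempty (D ≃+* D') := by
  have hA : Nontrivial A := φ.domain_nontrivial
  have hB : Nontrivial B := hj.nontrivial
  have hx : x ≠ 0 := by
    rintro rfl
    exact X.ne_zero (by rw [hX, map_zero])
  have hφx : φ x ≠ 0 := (map_ne_zero_iff φ hφ).2 hx
  obtain ⟨Θ, hΘ⟩ := exists_ringHom_of_right_fractions j φ hj fun b => by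
    obtain ⟨a, n, h⟩ := hjf b
    refine ⟨a, x ^ n, ?_, ?_, ?_⟩
    · rw [map_pow, ← hX]
      exact X.isUnit.pow n
    · rw [map_pow]
      exact (pow_ne_zero n hφx).isUnit
    · rw [map_pow, ← hX, h]
  have hΘ_inj : Function.Injective Θ := by
    refine (injective_iff_map_eq_zero Θ).2 fun b hb => ?_
    obtain ⟨a, n, h⟩ := hjf b
    have ha : a = 0 := hφ <| by rw [← hΘ, ← h, map_mul, hb, zero_mul, map_zero]
    rw [ha, map_zero, ← Units.val_pow_eq_pow_val] at h
    exact (Units.mul_left_eq_zero _).1 h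
  refine nonempty_ringEquiv_of_right_fractions (Θ.comp g) φ' (hΘ_inj.comp hg) (fun u => ?_) hφ' hφf'
  obtain ⟨a, b, hb, h⟩ := hφf u
  obtain ⟨a', n, ha'⟩ := hgf (j a)
  obtain ⟨b', m, hb'⟩ := hgf (j b)
  refine ⟨a' * y ^ m, b' * y ^ n, ?_, ?_⟩
  · intro h0
    apply hb
    apply hj
    have h1 := congrArg g h0
    rw [map_mul, map_pow, hy, ← hb', map_zero, mul_assoc, ← pow_add,
      ← Units.val_pow_eq_pow_val] at h1
    rw [(Units.mul_left_eq_zero _).1 h1, map_zero]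
  · have h1 : g (b' * y ^ n) = j (b * x ^ (n + m)) := by
      rw [map_mul, map_pow, hy, ← hb', map_mul, map_pow, ← hX, mul_assoc, ← pow_add, add_comm]
    have h2 : g (a' * y ^ m) = j (a * x ^ (n + m)) := by
      rw [map_mul, map_pow, hy, ← ha', map_mul, map_pow, ← hX, mul_assoc, ← pow_add]
    rw [RingHom.comp_apply, RingHom.comp_apply, h1, h2, hΘ, hΘ, map_mul, map_mul, ← mul_assoc, h]

end FractionRings

/-- The derivation-removing homomorphism `f : R → AS⁻¹` extends uniquely to an
injective `k`-algebra homomorphism `R[y; τ] → AS⁻¹` sending `y ↦ x`, and the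
further extension `R[y^{±1}; τ] → AS⁻¹` is an isomorphism (every element of
`AS⁻¹` is `g(a') x^{-n}`).  Consequently `A` is PI iff `R[y; τ]` is PI, in
which case they have the same PI degree; and if `R` is a noetherian domain then
`Fract A ≅ Fract R[y; τ]`. -/
theorem derivation_removing_structure
    {k R A A' B : Type*} [Field k] [Ring R] [Algebra k R]
    [Ring A] [Algebra k A] [Ring A'] [Algebra k A'] [Ring B] [Algebra k B]
    (q : k) (hq0 : q ≠ 0) (hq1 : q ≠ 1)
    (τ : R ≃ₐ[k] R) (δ : R →ₗ[k] R)
    (hder : ∀ r s : R, δ (r * s) = τ r * δ s + δ r * s)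
    (hskew : ∀ r : R, δ (τ r) = q • τ (δ r))
    (d : ℕ → R →ₗ[k] R)
    (hd0 : d 0 = LinearMap.id) (hd1 : d 1 = δ)
    (hprod : ∀ (n : ℕ) (r s : R), d n (r * s) =
        ∑ i ∈ Finset.range (n + 1), (⇑τ)^[n - i] (d i r) * d (n - i) s)
    (hdskew : ∀ (i : ℕ) (r : R), d i (τ r) = q ^ i • τ (d i r))
    (hiter : ∀ (i j : ℕ) (r : R), d i (d j r) = qBinom q (i + j) j • d (i + j) r)
    (hnil : ∀ r : R, ∃ N : ℕ, ∀ i ≥ N, d i r = 0)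
    -- `A = R[x; τ, δ]`:
    (ιA : R →ₐ[k] A) (x : A)
    (hrelA : ∀ r : R, x * ιA r = ιA (τ r) * x + ιA (δ r))
    (hbasisA : ∀ a : A, ∃! c : ℕ →₀ R, a = c.sum fun i r => ιA r * x ^ i)
    -- `B = AS⁻¹`, the localization of `A` at the Ore set `S` generated by `x`:
    (j : A →ₐ[k] B) (hj : Function.Injective j) (hu : IsUnit (j x))
    (hBfrac : ∀ b : B, ∃ (a : A) (n : ℕ), b = j a * ((hu.unit⁻¹ : Bˣ) : B) ^ n)
    -- `A' = R[y; τ]`: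
    (ιA' : R →ₐ[k] A') (y : A')
    (hrelA' : ∀ r : R, y * ιA' r = ιA' (τ r) * y)
    (hbasisA' : ∀ a : A', ∃! c : ℕ →₀ R, a = c.sum fun i r => ιA' r * y ^ i)
    -- the derivation-removing map `f : R → AS⁻¹`:
    (f : R → B)
    (hf : ∀ r : R, f r = ∑ᶠ n : ℕ,
        (q ^ (n * (n + 1) / 2) * ((q - 1)⁻¹) ^ n) •
          (j (ιA (d n ((⇑τ.symm)^[n] r))) * ((hu.unit⁻¹ : Bˣ) : B) ^ n)) :
    -- (1) unique extension `g : R[y; τ] → AS⁻¹` with `g ∘ ιA' = f`, `g y = x`: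
    (∃! g : A' →ₐ[k] B, (∀ r : R, g (ιA' r) = f r) ∧ g y = j x) ∧
    -- (2) any such extension is injective, and becomes an isomorphism upon
    -- inverting `y` (every element of `AS⁻¹` is a Laurent fraction `g(a')x⁻ⁿ`):
    (∀ g : A' →ₐ[k] B, (∀ r : R, g (ιA' r) = f r) → g y = j x →
        Function.Injective g ∧ ∀ b : B, ∃ (a' : A') (n : ℕ), b * j x ^ n = g a') ∧
    -- (3) PI degree parity between `A` and `R[y; τ]`:
    ((IsPIRing A ↔ IsPIRing A') ∧ piDeg A = piDeg A') ∧
    -- (4) if `R` is a noetherian domain, any division rings of fractions of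
    -- `A` and of `R[y; τ]` are isomorphic:
    (IsNoetherianRing R → IsDomain R →
      ∀ (D D' : Type*) [DivisionRing D] [DivisionRing D']
        (φ : A →+* D) (φ' : A' →+* D'),
        Function.Injective φ →
        (∀ u : D, ∃ a b : A, b ≠ 0 ∧ u * φ b = φ a) →
        Function.Injective φ' →
        (∀ u : D', ∃ a b : A', b ≠ 0 ∧ u * φ' b = φ' a) →
        Nonempty (D ≃+* D')) := by
  have hXj : ((hu.unit : Bˣ) : B) = j x := hu.unit_spec
  have h : IsRemovingMap q τ d (j.comp ιA) hu.unit f :=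
    { q_ne_zero := hq0
      q_ne_one := hq1
      d_zero := hd0
      d_mul := hprod
      d_skew := hdskew
      d_iter := hiter
      d_nil := hnil
      X_mul := fun r => by
        rw [hXj, hd1]
        simpa using congrArg j (hrelA r)
      map_eq := hf }
  have hA := bijective_skewEval hbasisA
  have hA' := bijective_skewEval hbasisA'
  have htop : ∀ b : B, ∃ m : ℤ, b ∈ laurentFilt f hu.unit m := fun b => by
    obtain ⟨m, hm⟩ := exists_mem_laurentFilt hA.2 hXj hBfrac b
    exact ⟨m, (h.laurentFilt_eq m).ge hm⟩
  have hlead : ∀ (r : R) (m : ℤ),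
      f r * (hu.unit ^ m : Bˣ) ∈ laurentFilt f hu.unit m → r = 0 := fun r m hr => by
    refine eq_zero_of_mul_zpow_mem_laurentFilt hA hj hXj (m := m) ?_
    have h1 := mul_zpow_mem_laurentFilt_add (h.sub_map_mem r) m
    rw [zero_add, sub_mul] at h1
    have h2 := add_mem h1 hr
    rw [sub_add_cancel, h.laurentFilt_eq] at h2
    exact h2
  obtain ⟨g, hg, hgy⟩ := exists_algHom_of_skew hA' hrelA' h.toAlgHom _ h.X_mul_map
  have hext : ∀ g : A' →ₐ[k] B, (∀ r : R, g (ιA' r) = f r) → g y = j x →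
      Function.Injective g ∧ ∀ b : B, ∃ (a' : A') (n : ℕ), b * j x ^ n = g a' := by
    intro g hg hgy
    rw [← hXj] at hgy ⊢
    exact ⟨injective_of_leadingCoeff hlead hA'.2 hg hgy, exists_mul_pow_eq htop hg hgy⟩
  have hginj := (hext g hg (hgy.trans hXj)).1
  have hAB : ∀ {n : ℕ} {c : Equiv.Perm (Fin n) → ℤ},
      IsMulLinIdentity A n c → IsMulLinIdentity B n c := by
    intro n c hc
    refine h.isMulLinIdentity_of_monomials htop fun r a => ?_
    simp only [← Units.val_pow_eq_pow_val, ← zpow_natCast]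
    refine h.mulLinEval_map_eq_zero hlead (a := fun i => (a i : ℤ)) ?_
    have := congrArg j (hc fun i => ιA (r i) * x ^ a i)
    rw [map_zero] at this
    refine Eq.trans ?_ this
    refine Eq.trans ?_ (map_mulLinEval (j : A →+* B) c _).symm
    congr 1
    funext i
    simp
  have hA'B : ∀ {n : ℕ} {c : Equiv.Perm (Fin n) → ℤ},
      IsMulLinIdentity A' n c → IsMulLinIdentity B n c := by
    intro n c hc
    refine h.isMulLinIdentity_of_monomials htop fun r a => ?_
    have := congrArg g (hc fun i => ιA' (r i) * y ^ a i)
    rw [map_zero] at this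
    refine Eq.trans ?_ this
    refine Eq.trans ?_ (map_mulLinEval (g : A' →+* B) c _).symm
    congr 1
    funext i
    simp [hg, hgy, h.toAlgHom_apply]
  have hiff : ∀ n : ℕ, SatisfiesMulLinIdentity A n ↔ SatisfiesMulLinIdentity A' n := fun n =>
    exists_congr fun c => and_congr_right fun _ =>
      ⟨fun hc => (hAB hc).of_injective (g : A' →+* B) hginj,
        fun hc => (hA'B hc).of_injective (j : A →+* B) hj⟩
  refine ⟨⟨g, ⟨hg, hgy.trans hXj⟩, ?_⟩, hext, ⟨?_, ?_⟩, ?_⟩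
  · rintro g' ⟨hg', hgy'⟩
    ext a
    induction (closure_monomials_eq_top hA'.2).ge (AddSubgroup.mem_top a) using
      AddSubgroup.closure_induction with
    | zero => simp
    | add a a' _ _ ha ha' => rw [map_add, map_add, ha, ha']
    | neg a _ ha => rw [map_neg, map_neg, ha]
    | mem a ha =>
      obtain ⟨r, i, rfl⟩ := ha
      rw [map_mul, map_mul, map_pow, map_pow, hg, hg', hgy, hgy', hXj, h.toAlgHom_apply]
  · simp only [IsPIRing, hiff]
  · simp only [piDeg, hiff]
  · intro _ _ D D' _ _ φ φ' hφ hφf hφ' hφf'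
    refine nonempty_ringEquiv_of_common_localization (j := (j : A →+* B)) hj hXj (fun b => ?_)
      (g := (g : A' →+* B)) hginj (exists_mul_pow_eq htop hg hgy) hgy hφ hφf hφ' hφf'
    obtain ⟨a, n, rfl⟩ := hBfrac b
    refine ⟨a, n, ?_⟩
    rw [mul_assoc, ← Units.val_pow_eq_pow_val, ← Units.val_pow_eq_pow_val, ← Units.val_mul, inv_pow,
      inv_mul_cancel, Units.val_one, mul_one]
    rfl
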